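/- Let L be a finite Galois extension of a field k and let X ⊂ ℙⁿ_k be a hypersurface of degree d ≤ n such that the base change X ×_k L is a union of d hyperplanes over L, i.e. X ×_k L = V(h₁⋯h_d) with h₁,…,h_d ∈ L[x₀,…,xₙ] homogeneous of degree 1. Then [X] ≡ 1 mod 𝕃 in K₀(Var_k), and X has a k-rational point. -/

import Mathlib

open AlgebraicGeometry CategoryTheory CategoryTheory.Limits MvPolynomial

universe u v

noncomputable section

attribute [local instance] MvPolynomial.gradedAlgebra

/-- The base scheme `Spec k`. -/
abbrev SpecBase (k : Type u) [Field k] : Scheme.{u} := Spec (CommRingCat.of k)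

/-- The affine line `𝔸¹_k` as a scheme over `k`. -/
def AffineLine (k : Type u) [Field k] : Scheme.{u} := Spec (CommRingCat.of (Polynomial k))

/-- The structure morphism of `𝔸¹_k`. -/
def AffineLine.toSpec (k : Type u) [Field k] : AffineLine k ⟶ SpecBase k :=
  Spec.map (CommRingCat.ofHom (algebraMap k (Polynomial k)))

/-- Projective `n`-space `ℙⁿ_k = Proj k[x₀, …, xₙ]` over `k`. -/
def ProjSpace (k : Type u) [Field k] (n : ℕ) : Scheme.{u} :=
  Proj (homogeneousSubmodule (Fin (n + 1)) k)

/-- The structure morphism of `ℙⁿ_k`. -/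
def ProjSpace.toSpec (k : Type u) [Field k] (n : ℕ) : ProjSpace k n ⟶ SpecBase k :=
  Proj.toSpecZero _ ≫ Spec.map (CommRingCat.ofHom (algebraMap k _))

/-- `X` (a scheme over `k` via `sX : X ⟶ Spec k`) is the reduced closed subvariety of `ℙⁿ_k`
cut out by the family `S` of polynomials, i.e. `X → ℙⁿ_k` is a closed immersion of the reduced
scheme `X` onto the zero locus of `S`, compatibly with the structure morphisms. -/
def IsProjSubvariety (k : Type u) [Field k] (n : ℕ) (S : Set (MvPolynomial (Fin (n + 1)) k))
    (X : Scheme.{u}) (sX : X ⟶ SpecBase k) : Prop :=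
  IsReduced X ∧ ∃ i : X ⟶ ProjSpace k n, IsClosedImmersion i ∧ i ≫ ProjSpace.toSpec k n = sX ∧
    Set.range i.base = ProjectiveSpectrum.zeroLocus (homogeneousSubmodule (Fin (n + 1)) k) S

/-- `X` has a `k`-rational point, i.e. the structure morphism has a section. -/
def HasRatPoint (k : Type u) [Field k] (X : Scheme.{u}) (sX : X ⟶ SpecBase k) : Prop :=
  ∃ p : SpecBase k ⟶ X, p ≫ sX = 𝟙 (SpecBase k)

/-- A motivic measure on varieties over `k` with values in a commutative ring `R`: an
assignment, to every scheme over `k`, of an element of `R` which, on separated schemes of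
finite type over `k` (i.e. on the category `Var_k`, reducedness being irrelevant), is
invariant under isomorphisms over `k`, satisfies the scissor relations
`[X] = [X ∖ Z] + [Z]` for closed subschemes `Z ⊆ X`, is multiplicative on fibre products
over `k`, and sends `Spec k` to `1`.  These are exactly the defining relations of the
Grothendieck ring of varieties `K₀(Var_k)`, so an identity holds in `K₀(Var_k)` if and
only if it holds for every motivic measure. -/
structure MotivicMeasure (k : Type u) [Field k] (R : Type v) [CommRing R] where
  cl : ∀ (X : Scheme.{u}), (X ⟶ SpecBase k) → R
  cl_point : cl (SpecBase k) (𝟙 (SpecBase k)) = 1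
  cl_iso : ∀ {X Y : Scheme.{u}} (sX : X ⟶ SpecBase k) (sY : Y ⟶ SpecBase k) (e : X ≅ Y),
    LocallyOfFiniteType sX → QuasiCompact sX → IsSeparated sX →
    e.hom ≫ sY = sX → cl X sX = cl Y sY
  cl_scissor : ∀ {X Z : Scheme.{u}} (sX : X ⟶ SpecBase k) (i : Z ⟶ X),
    LocallyOfFiniteType sX → QuasiCompact sX → IsSeparated sX →
    IsClosedImmersion i → ∀ U : X.Opens, (U : Set X) = (Set.range i.base)ᶜ →
    cl X sX = cl U.toScheme (U.ι ≫ sX) + cl Z (i ≫ sX)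
  cl_prod : ∀ {X Y : Scheme.{u}} (sX : X ⟶ SpecBase k) (sY : Y ⟶ SpecBase k),
    LocallyOfFiniteType sX → QuasiCompact sX → IsSeparated sX →
    LocallyOfFiniteType sY → QuasiCompact sY → IsSeparated sY →
    cl (pullback sX sY) (pullback.fst sX sY ≫ sX) = cl X sX * cl Y sY

/-- The class of the affine line, `𝕃 = [𝔸¹_k]`, under a motivic measure. -/
def MotivicMeasure.lef {k : Type u} [Field k] {R : Type v} [CommRing R]
    (μ : MotivicMeasure k R) : R :=
  μ.cl (AffineLine k) (AffineLine.toSpec k)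

/-- `X` and `Y` are birational over `k`: they contain isomorphic dense open subschemes. -/
def BirationalOver (k : Type u) [Field k] (X Y : Scheme.{u})
    (sX : X ⟶ SpecBase k) (sY : Y ⟶ SpecBase k) : Prop :=
  ∃ (U : X.Opens) (V : Y.Opens) (e : U.toScheme ≅ V.toScheme),
    Dense (U : Set X) ∧ Dense (V : Set Y) ∧ e.hom ≫ V.ι ≫ sY = U.ι ≫ sX

end

noncomputable section

section Translation

/-- A polynomial in `n + 1` variables is invariant under translations along the line spanned
by `v`. -/
def TranslationInvariant {k : Type u} [Field k] {n : ℕ} (v : Fin (n + 1) → k)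
    (s : MvPolynomial (Fin (n + 1)) k) : Prop :=
  ∀ (A : Type u) [CommRing A] [Algebra k A] (a : Fin (n + 1) → A) (t : A),
    aeval (fun i ↦ a i + t * algebraMap k A (v i)) s = aeval a s

section

variable {K B σ : Type*} [CommRing K] [CommRing B] [Algebra K B] {p : MvPolynomial σ K}

lemma aeval_mul_of_isHomogeneous_one (hp : p.IsHomogeneous 1) (c : σ → B) (t : B) :
    aeval (fun i ↦ t * c i) p = t * aeval c p := by
  rw [← mem_homogeneousSubmodule, homogeneousSubmodule_one_eq_span_X] at hp
  induction hp using Submodule.span_induction with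
  | mem x hx => obtain ⟨i, rfl⟩ := hx; simp
  | zero => simp
  | add x y _ _ hx hy => rw [map_add, hx, hy, map_add]; ring
  | smul r x _ hx => rw [map_smul, hx, map_smul, mul_smul_comm]

lemma aeval_add_mul_of_isHomogeneous_one (hp : p.IsHomogeneous 1) (a c : σ → B) (t : B) :
    aeval (fun i ↦ a i + t * c i) p = aeval a p + t * aeval c p := by
  rw [← mem_homogeneousSubmodule, homogeneousSubmodule_one_eq_span_X] at hp
  induction hp using Submodule.span_induction with
  | mem x hx => obtain ⟨i, rfl⟩ := hx; simp
  | zero => simp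
  | add x y _ _ hx hy => rw [map_add, hx, hy, map_add, map_add]; ring
  | smul r x _ hx => rw [map_smul, hx, map_smul, map_smul, smul_add, mul_smul_comm]

end

lemma aeval_add_mul_galois {k L : Type*} [Field k] [Field L] [Algebra k L] {n d : ℕ}
    {f : MvPolynomial (Fin (n + 1)) k} {h : Fin d → MvPolynomial (Fin (n + 1)) L}
    (hh : ∀ i, (h i).IsHomogeneous 1) (hsplit : MvPolynomial.map (algebraMap k L) f = ∏ i, h i)
    {w : Fin (n + 1) → L} (hw : ∀ i, aeval w (h i) = 0) (σ : L ≃ₐ[k] L)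
    {B : Type*} [CommRing B] [Algebra L B] (a : Fin (n + 1) → B) (t : B) :
    aeval (fun i ↦ a i + t * algebraMap L B (σ (w i))) (MvPolynomial.map (algebraMap k L) f) =
      aeval a (MvPolynomial.map (algebraMap k L) f) := by
  have key : MvPolynomial.map (algebraMap k L) f =
      ∏ i, MvPolynomial.map (σ : L →+* L) (h i) := by
    rw [← map_prod, ← hsplit, MvPolynomial.map_map]
    have : (σ : L →+* L).comp (algebraMap k L) = algebraMap k L := RingHom.ext fun x ↦ by simp
    rw [this]
  rw [key, map_prod, map_prod]
  refine Finset.prod_congr rfl fun i _ ↦ ?_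
  rw [aeval_add_mul_of_isHomogeneous_one ((hh i).map _)]
  have : aeval (fun j ↦ algebraMap L B (σ (w j))) (MvPolynomial.map (σ : L →+* L) (h i)) =
      algebraMap L B (σ (aeval w (h i))) := by
    rw [aeval_def, eval₂_map, aeval_def]
    exact (MvPolynomial.eval₂_comp_left ((algebraMap L B).comp (σ : L →+* L))
      (algebraMap L L) w (h i)).symm
  rw [this, hw, map_zero, map_zero, mul_zero, add_zero]

lemma exists_common_zero {L : Type*} [Field L] {n d : ℕ} (hdn : d ≤ n)
    {h : Fin d → MvPolynomial (Fin (n + 1)) L} (hh : ∀ i, (h i).IsHomogeneous 1) :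
    ∃ w : Fin (n + 1) → L, w ≠ 0 ∧ ∀ i, aeval w (h i) = 0 := by
  let φ : (Fin (n + 1) → L) →ₗ[L] (Fin d → L) :=
    { toFun := fun w i ↦ aeval w (h i)
      map_add' := fun a c ↦ funext fun i ↦ by
        simpa using! aeval_add_mul_of_isHomogeneous_one (hh i) a c 1
      map_smul' := fun r c ↦ funext fun i ↦ aeval_mul_of_isHomogeneous_one (hh i) c r }
  have := φ.ker_ne_bot_of_finrank_lt (by simp; lia)
  obtain ⟨w, hw, hw0⟩ := Submodule.exists_mem_ne_zero_of_ne_bot this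
  exact ⟨w, hw0, fun i ↦ congr_fun hw i⟩

lemma exists_translationInvariant {k : Type u} {L : Type v} [Field k] [Field L] [Algebra k L]
    [FiniteDimensional k L] [IsGalois k L] {n d : ℕ} (hdn : d ≤ n)
    {f : MvPolynomial (Fin (n + 1)) k} {h : Fin d → MvPolynomial (Fin (n + 1)) L}
    (hh : ∀ i, (h i).IsHomogeneous 1)
    (hsplit : MvPolynomial.map (algebraMap k L) f = ∏ i, h i) :
    ∃ (m : Fin (n + 1)) (v : Fin (n + 1) → k), v m = 1 ∧ TranslationInvariant v f := by
  classical
  obtain ⟨w, hw0, hw⟩ := exists_common_zero hdn hh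
  obtain ⟨m, hm⟩ := Function.ne_iff.mp hw0
  obtain ⟨y, hy⟩ := Algebra.trace_surjective k L 1
  let u : Fin (n + 1) → L := fun i ↦ y / w m * w i
  have hu : ∀ i, aeval u (h i) = 0 := fun i ↦ by
    rw [aeval_mul_of_isHomogeneous_one (hh i), hw, mul_zero]
  refine ⟨m, fun i ↦ Algebra.trace k L (u i), ?_, fun A _ _ a t ↦ ?_⟩
  · simpa [u, div_mul_cancel₀ y hm] using hy
  · apply Algebra.TensorProduct.includeRight_injective (R := k) (A := L) (B := A)
      (algebraMap k L).injective
    let b : Fin (n + 1) → TensorProduct k L A := fun i ↦ Algebra.TensorProduct.includeRight (a i)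
    let τ : TensorProduct k L A := Algebra.TensorProduct.includeRight t
    have key : ∀ S : Finset (L ≃ₐ[k] L), aeval (fun i ↦ b i + τ * algebraMap L _ (∑ σ ∈ S, σ (u i)))
        (MvPolynomial.map (algebraMap k L) f) = aeval b (MvPolynomial.map (algebraMap k L) f) := by
      intro S
      induction S using Finset.induction_on with
      | empty => simp
      | insert σ S hσ ih =>
        rw [← ih, ← aeval_add_mul_galois hh hsplit hu σ
          (fun i ↦ b i + τ * algebraMap L _ (∑ σ ∈ S, σ (u i))) τ]
        congr 2
        ext i
        rw [Finset.sum_insert hσ, map_add]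
        ring
    have := key Finset.univ
    simp only [← trace_eq_sum_automorphisms, MvPolynomial.aeval_map_algebraMap] at this
    rw [MvPolynomial.comp_aeval_apply, MvPolynomial.comp_aeval_apply]
    convert this using 3
    simp only [b, τ, map_add, map_mul, AlgHom.commutes]
    simp only [← IsScalarTower.algebraMap_apply k L (TensorProduct k L A)]

end Translation

section LinearForms

variable {k : Type u} [Field k] {n : ℕ}

/-- The linear form `xᵢ - vᵢ xₘ`, which vanishes at `v` when `vₘ = 1`. -/
def linearForm (v : Fin (n + 1) → k) (m i : Fin (n + 1)) : MvPolynomial (Fin (n + 1)) k :=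
  X i - C (v i) * X m

lemma isHomogeneous_linearForm (v : Fin (n + 1) → k) (m i : Fin (n + 1)) :
    (linearForm v m i).IsHomogeneous 1 := by
  refine (isHomogeneous_X k i).sub ?_
  simpa using (isHomogeneous_C (Fin (n + 1)) (v i)).mul (isHomogeneous_X k m)

lemma translationInvariant_linearForm {v : Fin (n + 1) → k} {m : Fin (n + 1)} (hv : v m = 1)
    (i : Fin (n + 1)) : TranslationInvariant v (linearForm v m i) := fun A _ _ a t ↦ by
  simp only [linearForm, map_sub, map_mul, aeval_X, aeval_C, hv, map_one]
  ring

lemma TranslationInvariant.mem_span_linearForm {v : Fin (n + 1) → k} {m : Fin (n + 1)}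
    {f : MvPolynomial (Fin (n + 1)) k} (hf : TranslationInvariant v f) {d : ℕ}
    (hfd : f.IsHomogeneous d) (hd : 1 ≤ d) :
    f ∈ Ideal.span (Set.range (linearForm v m)) := by
  let I := Ideal.span (Set.range (linearForm v m))
  have h := hf (MvPolynomial (Fin (n + 1)) k) X (-X m)
  rw [MvPolynomial.aeval_X_left_apply] at h
  rw [← Ideal.Quotient.eq_zero_iff_mem, ← h, ← Ideal.Quotient.mkₐ_eq_mk k,
    MvPolynomial.comp_aeval_apply]
  have : (fun i ↦ Ideal.Quotient.mkₐ k I (X i + -X m * algebraMap k _ (v i))) = 0 := by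
    ext i
    refine Ideal.Quotient.eq_zero_iff_mem.mpr (Ideal.subset_span ⟨i, ?_⟩)
    simp only [linearForm, algebraMap_eq]
    ring
  rw [this]
  simp only [MvPolynomial.aeval_zero, MvPolynomial.constantCoeff_eq]
  rw [hfd.coeff_eq_zero (by simp; lia), map_zero]

end LinearForms

section Cone

variable {k : Type u} [Field k] {n : ℕ}

instance Polynomial.isReduced {B : Type*} [CommRing B] [IsReduced B] :
    IsReduced (Polynomial B) where
  eq_zero p hp := by
    ext i
    simpa using Polynomial.isNilpotent_iff.mp hp i

/-- The coordinate ring of the hyperplane section `xₘ = 0` of the cone cut out by `S`. -/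
abbrev SectionRing (m : Fin (n + 1)) (S : Set (MvPolynomial (Fin (n + 1)) k)) : Type u :=
  MvPolynomial (Fin (n + 1)) k ⧸ (Ideal.span (insert (X m) S)).radical

instance (m : Fin (n + 1)) (S : Set (MvPolynomial (Fin (n + 1)) k)) :
    IsReduced (SectionRing m S) :=
  (Ideal.isRadical_iff_quotient_reduced _).mp (Ideal.radical_isRadical _)

/-- The parametrization `(b, t) ↦ b + t v` of a cone by its section `xₘ = 0` and the line
spanned by `v`. -/
def coneHom (v : Fin (n + 1) → k) (m : Fin (n + 1)) (S : Set (MvPolynomial (Fin (n + 1)) k)) :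
    MvPolynomial (Fin (n + 1)) k →ₐ[k] Polynomial (SectionRing m S) :=
  aeval (S₁ := Polynomial (SectionRing m S)) fun i ↦
    algebraMap (SectionRing m S) _ (Ideal.Quotient.mk _ (X i)) + Polynomial.X * algebraMap k _ (v i)

lemma mk_X_sectionRing (m : Fin (n + 1)) (S : Set (MvPolynomial (Fin (n + 1)) k)) :
    (Ideal.Quotient.mk _ (X m) : SectionRing m S) = 0 :=
  Ideal.Quotient.eq_zero_iff_mem.mpr (Ideal.le_radical (Ideal.subset_span (Set.mem_insert _ _)))

lemma mk_sectionRing {m : Fin (n + 1)} {S : Set (MvPolynomial (Fin (n + 1)) k)}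
    {s : MvPolynomial (Fin (n + 1)) k} (hs : s ∈ S) :
    (Ideal.Quotient.mk _ s : SectionRing m S) = 0 :=
  Ideal.Quotient.eq_zero_iff_mem.mpr
    (Ideal.le_radical (Ideal.subset_span (Set.mem_insert_of_mem _ hs)))

lemma coneHom_X_self {v : Fin (n + 1) → k} {m : Fin (n + 1)} (hv : v m = 1)
    (S : Set (MvPolynomial (Fin (n + 1)) k)) : coneHom v m S (X m) = Polynomial.X := by
  rw [coneHom, aeval_X, mk_X_sectionRing, hv]
  simp

lemma coneHom_surjective {v : Fin (n + 1) → k} {m : Fin (n + 1)} (hv : v m = 1)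
    (S : Set (MvPolynomial (Fin (n + 1)) k)) : Function.Surjective (coneHom v m S) := by
  have hC : ∀ b : SectionRing m S, Polynomial.C b ∈ (coneHom v m S).range := by
    intro b
    obtain ⟨p, rfl⟩ := Ideal.Quotient.mk_surjective b
    induction p using MvPolynomial.induction_on with
    | C r => exact ⟨C r, by simp [coneHom]; rfl⟩
    | add p q hp hq => simpa using add_mem hp hq
    | mul_X p i hp =>
      rw [map_mul, map_mul]
      refine mul_mem hp ⟨X i - C (v i) * X m, ?_⟩
      change coneHom v m S _ = _
      rw [map_sub, map_mul, coneHom_X_self hv, coneHom, aeval_X, aeval_C]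
      exact sub_eq_of_eq_add (congr_arg₂ (· + ·) rfl Polynomial.X_mul)
  intro p
  change p ∈ (coneHom v m S).range
  induction p using Polynomial.induction_on' with
  | add p q hp hq => exact add_mem hp hq
  | monomial i b =>
    rw [← Polynomial.C_mul_X_pow_eq_monomial]
    have hX : Polynomial.X ∈ (coneHom v m S).range := ⟨X m, coneHom_X_self hv S⟩
    exact mul_mem (hC b) (pow_mem hX i)

lemma zeroLocus_ker_coneHom {v : Fin (n + 1) → k} {m : Fin (n + 1)} (hv : v m = 1)
    {S : Set (MvPolynomial (Fin (n + 1)) k)} (hS : ∀ s ∈ S, TranslationInvariant v s) :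
    PrimeSpectrum.zeroLocus (RingHom.ker (coneHom v m S) : Set (MvPolynomial (Fin (n + 1)) k)) =
      PrimeSpectrum.zeroLocus S := by
  apply subset_antisymm
  · refine PrimeSpectrum.zeroLocus_anti_mono fun s hs ↦ ?_
    change coneHom v m S s = 0
    refine (hS s hs (Polynomial (SectionRing m S)) _ _).trans ?_
    have := MvPolynomial.comp_aeval_apply (R := k) (B := Polynomial (SectionRing m S))
      X ((IsScalarTower.toAlgHom k (SectionRing m S) (Polynomial (SectionRing m S))).comp
        (Ideal.Quotient.mkₐ k _)) s
    rw [MvPolynomial.aeval_X_left_apply] at this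
    refine this.symm.trans ?_
    simp [mk_sectionRing hs]
  · rw [← PrimeSpectrum.zeroLocus_span S, ← PrimeSpectrum.zeroLocus_radical (Ideal.span S)]
    refine PrimeSpectrum.zeroLocus_anti_mono fun p hp ↦ ?_
    let I := (Ideal.span S).radical
    have hI : I.IsRadical := Ideal.radical_isRadical _
    let q : MvPolynomial (Fin (n + 1)) k →ₐ[k] MvPolynomial (Fin (n + 1)) k ⧸ I :=
      Ideal.Quotient.mkₐ k I
    let π : MvPolynomial (Fin (n + 1)) k →ₐ[k] MvPolynomial (Fin (n + 1)) k ⧸ I :=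
      aeval fun i ↦ q (X i) + -q (X m) * algebraMap k _ (v i)
    have hred : IsReduced (MvPolynomial (Fin (n + 1)) k ⧸ I) :=
      (Ideal.isRadical_iff_quotient_reduced _).mp hI
    have hπ : ∀ a ∈ (Ideal.span (insert (X m) S)).radical, π a = 0 := by
      change _ ≤ RingHom.ker π
      have hker : (RingHom.ker π).IsRadical := fun x ⟨r, hr⟩ ↦
        hred.eq_zero _ ⟨r, by rw [← map_pow]; exact hr⟩
      rw [hker.radical_le_iff, Ideal.span_le]
      rintro a (rfl | ha)
      · change π (X m) = 0
        simp [π, hv]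
      · change π a = 0
        simp only [π]
        rw [hS a ha, ← MvPolynomial.comp_aeval_apply, MvPolynomial.aeval_X_left_apply]
        exact Ideal.Quotient.eq_zero_iff_mem.mpr (Ideal.le_radical (Ideal.subset_span ha))
    let π' : SectionRing m S →ₐ[k] MvPolynomial (Fin (n + 1)) k ⧸ I := Ideal.Quotient.liftₐ _ π hπ
    let ρ : Polynomial (SectionRing m S) →+* MvPolynomial (Fin (n + 1)) k ⧸ I :=
      Polynomial.eval₂RingHom π' (q (X m))
    have hρ : ρ.comp (coneHom v m S : MvPolynomial (Fin (n + 1)) k →+* _) = q := by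
      apply MvPolynomial.ringHom_ext
      · intro r
        simp [ρ, coneHom]
      · intro i
        have h1 : π' (Ideal.Quotient.mk _ (X i)) = π (X i) := Ideal.Quotient.lift_mk _ _ _
        simp [ρ, coneHom, h1]
        simp [π]
        ring
    have hp0 : coneHom v m S p = 0 := hp
    have := congr($hρ p)
    rw [RingHom.comp_apply, RingHom.coe_coe, hp0, map_zero] at this
    exact Ideal.Quotient.eq_zero_iff_mem.mp this.symm

/-- A cone with apex direction `v` is a product with the affine line, in affine terms. -/
lemma exists_coneRing {v : Fin (n + 1) → k} {m : Fin (n + 1)} (hv : v m = 1)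
    {S : Set (MvPolynomial (Fin (n + 1)) k)} (hS : ∀ s ∈ S, TranslationInvariant v s) :
    ∃ (B : Type u) (_ : CommRing B) (_ : Algebra k B) (_ : _root_.IsReduced B)
      (_ : Algebra.FiniteType k B) (g : MvPolynomial (Fin (n + 1)) k →ₐ[k] Polynomial B),
      Function.Surjective g ∧
      PrimeSpectrum.zeroLocus (RingHom.ker g : Set (MvPolynomial (Fin (n + 1)) k)) =
      PrimeSpectrum.zeroLocus S :=
  ⟨SectionRing m S, inferInstance, inferInstance, inferInstance, inferInstance,
    coneHom v m S, coneHom_surjective hv S, zeroLocus_ker_coneHom hv hS⟩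

end Cone

section Chart

variable {k : Type u} [Field k] {n : ℕ}

attribute [local instance] MvPolynomial.gradedAlgebra

lemma aeval_const_mul_of_isHomogeneous {K B σ : Type*} [CommRing K] [CommRing B] [Algebra K B]
    {p : MvPolynomial σ K} {e : ℕ} (hp : p.IsHomogeneous e) (c : B) (b : σ → B) :
    aeval (fun i ↦ c * b i) p = c ^ e * aeval b p := by
  classical
  rw [aeval_def, aeval_def, eval₂_eq, eval₂_eq, Finset.mul_sum]
  refine Finset.sum_congr rfl fun m hm ↦ ?_
  have : ∑ i ∈ m.support, m i = e := by
    simpa [Finsupp.weight_apply, Finsupp.sum] using hp (mem_support_iff.mp hm)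
  simp_rw [mul_pow, Finset.prod_mul_distrib, Finset.prod_pow_eq_pow_sum, this]
  ring

/-- The coordinate ring of the standard chart `D₊(l)` of projective space. -/
abbrev ChartRing (l : MvPolynomial (Fin (n + 1)) k) : Type u :=
  HomogeneousLocalization.Away (homogeneousSubmodule (Fin (n + 1)) k) l

instance (l : MvPolynomial (Fin (n + 1)) k) : Algebra k (ChartRing l) :=
  ((HomogeneousLocalization.fromZeroRingHom (homogeneousSubmodule (Fin (n + 1)) k) _).comp
    (algebraMap k (homogeneousSubmodule (Fin (n + 1)) k 0))).toAlgebra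

variable {l : MvPolynomial (Fin (n + 1)) k}

/-- The surjection `xᵢ ↦ xᵢ / l` from the polynomial ring onto the coordinate ring of the chart
`D₊(l)`, for a linear form `l`. It identifies the chart with the hyperplane `l = 1`. -/
def chartHom (hl : l ∈ homogeneousSubmodule (Fin (n + 1)) k 1) :
    MvPolynomial (Fin (n + 1)) k →ₐ[k] ChartRing l :=
  aeval fun i ↦ HomogeneousLocalization.Away.mk _ hl 1 (X i) (by simpa using isHomogeneous_X k i)

/-- The inclusion of the coordinate ring of the chart `D₊(l)` in the localization away from `l`. -/
def chartVal (l : MvPolynomial (Fin (n + 1)) k) : ChartRing l →ₐ[k] Localization.Away l where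
  toRingHom := algebraMap (ChartRing l) (Localization.Away l)
  commutes' _ := rfl

lemma chartVal_injective (l : MvPolynomial (Fin (n + 1)) k) :
    Function.Injective (chartVal l) :=
  HomogeneousLocalization.val_injective _

lemma chartVal_mk (hl : l ∈ homogeneousSubmodule (Fin (n + 1)) k 1) (e : ℕ)
    (p : MvPolynomial (Fin (n + 1)) k)
    (hp : p ∈ homogeneousSubmodule (Fin (n + 1)) k (e • 1)) :
    algebraMap _ (Localization.Away l) l ^ e *
      chartVal l (HomogeneousLocalization.Away.mk _ hl e p hp) = algebraMap _ _ p := by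
  change _ * HomogeneousLocalization.val
    (HomogeneousLocalization.Away.mk (homogeneousSubmodule (Fin (n + 1)) k) hl e p hp) = _
  rw [HomogeneousLocalization.Away.val_mk, Localization.mk_eq_mk', ← map_pow]
  exact IsLocalization.mk'_spec' (M := Submonoid.powers l) _ p ⟨l ^ e, e, rfl⟩

lemma chartHom_eq_mk (hl : l ∈ homogeneousSubmodule (Fin (n + 1)) k 1) {e : ℕ}
    {p : MvPolynomial (Fin (n + 1)) k} (hp : p.IsHomogeneous e)
    (hp' : p ∈ homogeneousSubmodule (Fin (n + 1)) k (e • 1)) :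
    chartHom hl p = HomogeneousLocalization.Away.mk _ hl e p hp' := by
  apply chartVal_injective l
  refine ((IsLocalization.Away.algebraMap_isUnit (S := Localization.Away l) l).pow
    e).mul_left_cancel ?_
  rw [chartVal_mk, chartHom, MvPolynomial.comp_aeval_apply, ← aeval_const_mul_of_isHomogeneous hp]
  have (i : Fin (n + 1)) := chartVal_mk hl 1 (X i) (by simpa using isHomogeneous_X k i)
  simp only [pow_one] at this
  simp_rw [this]
  rw [← IsScalarTower.coe_toAlgHom' k, ← MvPolynomial.comp_aeval_apply, aeval_X_left_apply]

lemma chartHom_surjective (hl : l ∈ homogeneousSubmodule (Fin (n + 1)) k 1) :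
    Function.Surjective (chartHom hl) := fun x ↦ by
  obtain ⟨e, a, ha, rfl⟩ := HomogeneousLocalization.Away.mk_surjective _ hl x
  exact ⟨a, chartHom_eq_mk hl (by simpa using ha) ha⟩

lemma chartHom_self (hl : l ∈ homogeneousSubmodule (Fin (n + 1)) k 1) : chartHom hl l = 1 := by
  apply chartVal_injective l
  refine ((IsLocalization.Away.algebraMap_isUnit (S := Localization.Away l) l).pow
    1).mul_left_cancel ?_
  rw [chartHom_eq_mk hl hl (by simpa using hl), chartVal_mk, map_one, pow_one, mul_one]

lemma ker_chartHom (hl : l ∈ homogeneousSubmodule (Fin (n + 1)) k 1) :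
    RingHom.ker (chartHom hl) = Ideal.span {l - 1} := by
  apply le_antisymm
  · intro p hp
    have hl1 : Ideal.Quotient.mk (Ideal.span {l - 1}) l = 1 :=
      Ideal.Quotient.eq.mpr (Ideal.subset_span rfl)
    let g : Localization.Away l →+* MvPolynomial (Fin (n + 1)) k ⧸ Ideal.span {l - 1} :=
      IsLocalization.Away.lift l (g := Ideal.Quotient.mk _) (by rw [hl1]; exact isUnit_one)
    have hg (p) : g (algebraMap _ _ p) = Ideal.Quotient.mk _ p := IsLocalization.Away.lift_eq ..
    have key : (g.comp ((chartVal l).comp (chartHom hl)).toRingHom) = Ideal.Quotient.mk _ := by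
      apply MvPolynomial.ringHom_ext
      · intro c
        have : chartVal l (chartHom hl (C c)) =
            algebraMap (MvPolynomial (Fin (n + 1)) k) _ (C c) := by
          rw [← MvPolynomial.algebraMap_eq, AlgHom.commutes, AlgHom.commutes]
          exact IsScalarTower.algebraMap_apply ..
        simp only [RingHom.comp_apply, AlgHom.toRingHom_eq_coe, RingHom.coe_coe, AlgHom.comp_apply]
        rw [this, hg]
      · intro i
        have := congr(g $(chartVal_mk hl 1 (X i) (by simpa using isHomogeneous_X k i)))
        rw [map_mul, map_pow, hg, hg, hl1, one_pow, one_mul] at this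
        simpa [chartHom] using this
    rw [← Ideal.Quotient.eq_zero_iff_mem, ← key]
    have hp : chartHom hl p = 0 := hp
    simp [hp]
  · rw [Ideal.span_le, Set.singleton_subset_iff]
    simp [RingHom.mem_ker, chartHom_self]

lemma chartHom_isLocalizationElem (hl : l ∈ homogeneousSubmodule (Fin (n + 1)) k 1) {e : ℕ}
    {p : MvPolynomial (Fin (n + 1)) k} (hp : p ∈ homogeneousSubmodule (Fin (n + 1)) k e) :
    HomogeneousLocalization.Away.isLocalizationElem hl hp = chartHom hl p := by
  rw [chartHom_eq_mk hl hp (by simpa using hp)]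
  simp [HomogeneousLocalization.Away.isLocalizationElem]

end Chart

section ReducedClosedSubschemes

open AlgebraicGeometry.Scheme

lemma ker_eq_vanishingIdeal {X P : Scheme.{u}} [AlgebraicGeometry.IsReduced X] (a : X ⟶ P)
    [QuasiCompact a] :
    a.ker = IdealSheafData.vanishingIdeal (.closure (Set.range a)) := by
  rw [← IdealSheafData.map_bot, ← nilradical_eq_bot, ← IdealSheafData.vanishingIdeal_top,
    IdealSheafData.map_vanishingIdeal]
  congr 2
  simp

/-- Reduced closed subschemes with the same underlying set are isomorphic. -/
lemma exists_iso_of_range_eq {X Y P : Scheme.{u}} [AlgebraicGeometry.IsReduced X]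
    [AlgebraicGeometry.IsReduced Y] (a : X ⟶ P) (b : Y ⟶ P) [IsClosedImmersion a]
    [IsClosedImmersion b] (h : Set.range a = Set.range b) : ∃ e : X ≅ Y, e.hom ≫ b = a := by
  have hker : b.ker = a.ker := by rw [ker_eq_vanishingIdeal, ker_eq_vanishingIdeal, h]
  have := IsClosedImmersion.isIso_lift b a hker
  exact ⟨asIso (IsClosedImmersion.lift b a hker.le), IsClosedImmersion.lift_fac ..⟩

instance isReduced_subscheme_vanishingIdeal {X : Scheme.{u}} (Z : TopologicalSpace.Closeds X) :
    AlgebraicGeometry.IsReduced (IdealSheafData.vanishingIdeal Z).subscheme := by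
  have (U : X.affineOpens) : AlgebraicGeometry.IsReduced
      ((IdealSheafData.vanishingIdeal Z).subschemeCover.openCover.X U) := by
    have : _root_.IsReduced (Γ(X, U) ⧸ (IdealSheafData.vanishingIdeal Z).ideal U) :=
      (Ideal.isRadical_iff_quotient_reduced _).mp (PrimeSpectrum.isRadical_vanishingIdeal _)
    exact inferInstanceAs (AlgebraicGeometry.IsReduced
      (Spec (.of (Γ(X, U) ⧸ (IdealSheafData.vanishingIdeal Z).ideal U))))
  exact @AlgebraicGeometry.IsReduced.of_openCover _
    (IdealSheafData.vanishingIdeal Z).subschemeCover.openCover this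

/-- Every closed subset carries a reduced closed subscheme structure. -/
lemma exists_reduced_closedImmersion {X : Scheme.{u}} {Z : Set X} (hZ : IsClosed Z) :
    ∃ (Y : Scheme.{u}) (i : Y ⟶ X), AlgebraicGeometry.IsReduced Y ∧ IsClosedImmersion i ∧
      Set.range i = Z :=
  ⟨_, (IdealSheafData.vanishingIdeal ⟨Z, hZ⟩).subschemeι, inferInstance, inferInstance, by
    rw [IdealSheafData.range_subschemeι, IdealSheafData.coe_support_vanishingIdeal]
    rfl⟩

end ReducedClosedSubschemes

section ConeClass

variable {k : Type u} [Field k] {n : ℕ}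

/-- The structure morphism of the spectrum of a `k`-algebra. -/
abbrev specStr (k B : Type u) [Field k] [CommRing B] [Algebra k B] :
    Spec (CommRingCat.of B) ⟶ SpecBase k :=
  Spec.map (CommRingCat.ofHom (algebraMap k B))

instance (B : Type u) [CommRing B] [Algebra k B] [Algebra.FiniteType k B] :
    LocallyOfFiniteType (specStr k B) :=
  (HasRingHomProperty.Spec_iff (P := @LocallyOfFiniteType)).mpr
    (RingHom.finiteType_algebraMap.mpr ‹_›)

/-- The morphism of spectra induced by a homomorphism of `k`-algebras. -/
abbrev specMap {A B : Type u} [CommRing A] [Algebra k A] [CommRing B] [Algebra k B]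
    (g : A →ₐ[k] B) : Spec (CommRingCat.of B) ⟶ Spec (CommRingCat.of A) :=
  Spec.map (CommRingCat.ofHom g.toRingHom)

lemma specMap_specStr {A B : Type u} [CommRing A] [Algebra k A] [CommRing B] [Algebra k B]
    (g : A →ₐ[k] B) :
    specMap g ≫ specStr k A = specStr k B := by
  rw [← Spec.map_comp, ← CommRingCat.ofHom_comp]
  congr 2
  exact g.comp_algebraMap

attribute [local instance] Polynomial.algebra in
lemma MotivicMeasure.cl_polynomial {R : Type v} [CommRing R] (μ : MotivicMeasure k R)
    (B : Type u) [CommRing B] [Algebra k B] [Algebra.FiniteType k B] :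
    μ.cl _ (specStr k (Polynomial B)) = μ.cl _ (specStr k B) * μ.lef := by
  have sq := (isPullback_SpecMap_of_isPushout _ _ _ _
    (CommRingCat.isPushout_of_isPushout k B (Polynomial k) (Polynomial B)))
  rw [MotivicMeasure.lef, ← μ.cl_prod]
  · refine μ.cl_iso _ _ sq.isoPullback ?_ ?_ ?_ ?_
    · infer_instance
    · infer_instance
    · infer_instance
    · rw [← Category.assoc]
      erw [sq.isoPullback_hom_fst]
      rw [← Spec.map_comp, ← CommRingCat.ofHom_comp, ← IsScalarTower.algebraMap_eq]
  · infer_instance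
  · infer_instance
  · infer_instance
  · exact inferInstanceAs (LocallyOfFiniteType (specStr k (Polynomial k)))
  · exact inferInstanceAs (QuasiCompact (specStr k (Polynomial k)))
  · exact inferInstanceAs (IsSeparated (specStr k (Polynomial k)))

lemma range_specMap_of_surjective {A B : Type u} [CommRing A] [Algebra k A] [CommRing B]
    [Algebra k B] (g : A →ₐ[k] B) (hg : Function.Surjective g) :
    Set.range (specMap g) =
      PrimeSpectrum.zeroLocus (RingHom.ker g : Set A) :=
  range_comap_of_surjective _ g.toRingHom hg

/-- A reduced closed subscheme of an affine scheme is the spectrum of a reduced quotient. -/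
lemma exists_iso_spec_of_range_eq {A B : Type u} [CommRing A] [Algebra k A] [CommRing B]
    [Algebra k B] [_root_.IsReduced B] {U : Scheme.{u}} [AlgebraicGeometry.IsReduced U]
    (j : U ⟶ Spec (.of A)) [IsClosedImmersion j] (g : A →ₐ[k] B) (hg : Function.Surjective g)
    (hr : Set.range j = PrimeSpectrum.zeroLocus (RingHom.ker g : Set A)) :
    ∃ e : U ≅ Spec (.of B), e.hom ≫ specStr k B = j ≫ specStr k A := by
  have : IsClosedImmersion (specMap g) := .spec_of_surjective _ hg
  obtain ⟨e, he⟩ := exists_iso_of_range_eq j (specMap g)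
    (hr.trans (range_specMap_of_surjective g hg).symm)
  exact ⟨e, by rw [← he, Category.assoc, specMap_specStr]⟩

lemma MotivicMeasure.cl_eq_of_iso_spec {R : Type v} [CommRing R] (μ : MotivicMeasure k R)
    {A B : Type u} [CommRing A] [Algebra k A] [CommRing B] [Algebra k B]
    [Algebra.FiniteType k A] {U : Scheme.{u}} (j : U ⟶ Spec (.of A)) [IsClosedImmersion j]
    (e : U ≅ Spec (.of B)) (he : e.hom ≫ specStr k B = j ≫ specStr k A) :
    μ.cl U (j ≫ specStr k A) = μ.cl _ (specStr k B) :=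
  μ.cl_iso _ _ e inferInstance inferInstance inferInstance he

/-- The class of a cone over a point of affine space is divisible by the class of the line. -/
lemma MotivicMeasure.cl_cone_mem {R : Type v} [CommRing R] (μ : MotivicMeasure k R)
    {v : Fin (n + 1) → k} {m : Fin (n + 1)} (hv : v m = 1)
    {S : Set (MvPolynomial (Fin (n + 1)) k)} (hS : ∀ s ∈ S, TranslationInvariant v s)
    {U : Scheme.{u}} [AlgebraicGeometry.IsReduced U]
    (j : U ⟶ Spec (.of (MvPolynomial (Fin (n + 1)) k))) [IsClosedImmersion j]
    (hr : Set.range j = PrimeSpectrum.zeroLocus S) :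
    μ.cl U (j ≫ specStr k _) ∈ Ideal.span {μ.lef} := by
  obtain ⟨B, _, _, _, _, g, hg, hgS⟩ := exists_coneRing hv hS
  obtain ⟨e, he⟩ := exists_iso_spec_of_range_eq j g hg (hr.trans hgS.symm)
  rw [μ.cl_eq_of_iso_spec j e he, μ.cl_polynomial]
  exact Ideal.mul_mem_left _ _ (Ideal.subset_span rfl)

end ConeClass

section ProjectiveCharts

variable {k : Type u} [Field k] {n : ℕ}

attribute [local instance] MvPolynomial.gradedAlgebra

/-- The inclusion of the chart `D₊(l)` in projective space. -/
def chartIncl {l : MvPolynomial (Fin (n + 1)) k} (hl : l ∈ homogeneousSubmodule (Fin (n + 1)) k 1) :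
    Spec (.of (ChartRing l)) ⟶ ProjSpace k n :=
  Proj.awayι _ l hl one_pos

lemma chartIncl_toSpec {l : MvPolynomial (Fin (n + 1)) k}
    (hl : l ∈ homogeneousSubmodule (Fin (n + 1)) k 1) :
    chartIncl hl ≫ ProjSpace.toSpec k n = specStr k (ChartRing l) := by
  refine (Proj.awayι_toSpecZero_assoc _ _ hl one_pos _).trans ?_
  rw [← Spec.map_comp, ← CommRingCat.ofHom_comp]

lemma chartIncl_mem_zeroLocus_iff {l : MvPolynomial (Fin (n + 1)) k}
    (hl : l ∈ homogeneousSubmodule (Fin (n + 1)) k 1) {S : Set (MvPolynomial (Fin (n + 1)) k)}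
    (hS : ∀ s ∈ S, ∃ e, 0 < e ∧ s.IsHomogeneous e) (y : Spec (.of (ChartRing l))) :
    chartIncl hl y ∈ ProjectiveSpectrum.zeroLocus (homogeneousSubmodule (Fin (n + 1)) k) S ↔
      ∀ s ∈ S, chartHom hl s ∈ y.asIdeal := by
  refine forall₂_congr fun s hs ↦ ?_
  obtain ⟨e, he, hse⟩ := hS s hs
  have := congr(y ∈ $(Proj.awayι_preimage_basicOpen (homogeneousSubmodule (Fin (n + 1)) k) hl
    one_pos hse he))
  rw [chartHom_isLocalizationElem hl hse] at this
  exact not_iff_not.mp (iff_of_eq this)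

/-- The intersection of a closed subscheme of projective space with a chart, as a closed subscheme
of affine space. -/
lemma exists_chart_closedImmersion {X : Scheme.{u}} (i : X ⟶ ProjSpace k n) [IsClosedImmersion i]
    {l : MvPolynomial (Fin (n + 1)) k} (hl : l ∈ homogeneousSubmodule (Fin (n + 1)) k 1)
    {S : Set (MvPolynomial (Fin (n + 1)) k)} (hS : ∀ s ∈ S, ∃ e, 0 < e ∧ s.IsHomogeneous e)
    (hr : Set.range i =
      ProjectiveSpectrum.zeroLocus (homogeneousSubmodule (Fin (n + 1)) k) S) :
    ∃ (U : X.Opens) (j : U.toScheme ⟶ Spec (.of (MvPolynomial (Fin (n + 1)) k))),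
      IsClosedImmersion j ∧ j ≫ specStr k _ = U.ι ≫ i ≫ ProjSpace.toSpec k n ∧
      Set.range j = PrimeSpectrum.zeroLocus (insert (l - 1) S) ∧
      ∀ x : X, x ∈ U ↔
        i x ∉ ProjectiveSpectrum.zeroLocus (homogeneousSubmodule (Fin (n + 1)) k) {l} := by
  let D : (ProjSpace k n).Opens := Proj.basicOpen (homogeneousSubmodule (Fin (n + 1)) k) l
  let ε : D.toScheme ≅ Spec (.of (ChartRing l)) :=
    Proj.basicOpenIsoSpec (homogeneousSubmodule (Fin (n + 1)) k) l hl one_pos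
  have hε : ε.hom ≫ chartIncl hl = D.ι := by
    rw [← Iso.eq_inv_comp]; rfl
  let c := specMap (chartHom hl)
  have : IsClosedImmersion c := .spec_of_surjective _ (chartHom_surjective hl)
  have hi : ((i ∣_ D) ≫ ε.hom) ≫ chartIncl hl = (i ⁻¹ᵁ D).ι ≫ i := by
    rw [Category.assoc, hε, morphismRestrict_ι]
  have hrange : Set.range ((i ∣_ D) ≫ ε.hom) = chartIncl hl ⁻¹' Set.range i := by
    ext y
    constructor
    · rintro ⟨x, rfl⟩
      exact ⟨(i ⁻¹ᵁ D).ι x, congr($hi.symm x)⟩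
    · rintro ⟨x, hx⟩
      have hy : D.ι (ε.inv y) = i x := by
        rw [hx]
        rw [← hε]
        exact congr($(Iso.inv_hom_id_assoc ε (chartIncl hl)) y)
      have hx : x ∈ i ⁻¹ᵁ D := by
        change i x ∈ D
        rw [← hy]
        exact (ε.inv y).2
      have hxy : (i ∣_ D) ⟨x, hx⟩ = ε.inv y :=
        D.ι.injective (congr($(morphismRestrict_ι i D) ⟨x, hx⟩).trans hy.symm)
      exact ⟨⟨x, hx⟩, congr(ε.hom $hxy).trans congr($(ε.inv_hom_id) y)⟩
  refine ⟨i ⁻¹ᵁ D, ((i ∣_ D) ≫ ε.hom) ≫ c, inferInstance, ?_, ?_, fun x ↦ ?_⟩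
  · rw [Category.assoc, specMap_specStr, ← chartIncl_toSpec hl, ← Category.assoc, hi,
      Category.assoc]
  · have hcomp : Set.range (((i ∣_ D) ≫ ε.hom) ≫ c) = c '' (chartIncl hl ⁻¹' Set.range i) := by
      rw [← hrange, ← Set.range_comp]
      rfl
    rw [hcomp, hr]
    ext z
    constructor
    · rintro ⟨y, hy, rfl⟩ s (rfl | hs)
      · change chartHom hl (l - 1) ∈ y.asIdeal
        simp [chartHom_self]
      · exact (chartIncl_mem_zeroLocus_iff hl hS y).mp hy s hs
    · intro hz
      have : z ∈ Set.range c := by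
        rw [range_specMap_of_surjective _ (chartHom_surjective hl), ker_chartHom,
          PrimeSpectrum.zeroLocus_span]
        exact Set.singleton_subset_iff.mpr (hz (Set.mem_insert _ _))
      obtain ⟨y, rfl⟩ := this
      exact ⟨y, (chartIncl_mem_zeroLocus_iff hl hS y).mpr fun s hs ↦
        hz (Set.mem_insert_of_mem _ hs), rfl⟩
  · exact not_congr (Set.singleton_subset_iff (a := l)).symm

end ProjectiveCharts

section Stratification

variable {k : Type u} [Field k] {n : ℕ}

attribute [local instance] MvPolynomial.gradedAlgebra

lemma algebraMap_homogeneousSubmodule_zero_surjective :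
    Function.Surjective (algebraMap k (homogeneousSubmodule (Fin (n + 1)) k 0)) := by
  rintro ⟨x, hx⟩
  rw [homogeneousSubmodule_zero, Submodule.mem_one] at hx
  obtain ⟨a, rfl⟩ := hx
  exact ⟨a, rfl⟩

instance : Algebra.FiniteType (homogeneousSubmodule (Fin (n + 1)) k 0)
    (MvPolynomial (Fin (n + 1)) k) :=
  have : IsScalarTower k (homogeneousSubmodule (Fin (n + 1)) k 0) (MvPolynomial (Fin (n + 1)) k) :=
    ⟨fun a b x ↦ smul_mul_assoc a (b : MvPolynomial (Fin (n + 1)) k) x⟩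
  .of_restrictScalars_finiteType k _ _

instance isClosedImmersion_spec_zero : IsClosedImmersion (Spec.map (CommRingCat.ofHom
    (algebraMap k (homogeneousSubmodule (Fin (n + 1)) k 0)))) :=
  .spec_of_surjective _ algebraMap_homogeneousSubmodule_zero_surjective

instance : LocallyOfFiniteType (ProjSpace.toSpec k n) :=
  inferInstanceAs (LocallyOfFiniteType (Proj.toSpecZero _ ≫ Spec.map (CommRingCat.ofHom
    (algebraMap k (homogeneousSubmodule (Fin (n + 1)) k 0)))))

instance : QuasiCompact (ProjSpace.toSpec k n) :=
  inferInstanceAs (QuasiCompact (Proj.toSpecZero _ ≫ Spec.map (CommRingCat.ofHom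
    (algebraMap k (homogeneousSubmodule (Fin (n + 1)) k 0)))))

instance : IsSeparated (ProjSpace.toSpec k n) :=
  inferInstanceAs (IsSeparated (Proj.toSpecZero _ ≫ Spec.map (CommRingCat.ofHom
    (algebraMap k (homogeneousSubmodule (Fin (n + 1)) k 0)))))

/-- A reduced closed subvariety of projective space is the disjoint union of its intersection with
the chart `D₊(l)`, which is closed in affine space, and its intersection with `V₊(l)`. -/
lemma exists_hyperplane_decomposition {X : Scheme.{u}} (i : X ⟶ ProjSpace k n)
    [IsClosedImmersion i] {l : MvPolynomial (Fin (n + 1)) k}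
    (hl : l ∈ homogeneousSubmodule (Fin (n + 1)) k 1)
    {S : Set (MvPolynomial (Fin (n + 1)) k)} (hS : ∀ s ∈ S, ∃ e, 0 < e ∧ s.IsHomogeneous e)
    (hr : Set.range i =
      ProjectiveSpectrum.zeroLocus (homogeneousSubmodule (Fin (n + 1)) k) S) :
    ∃ (U : X.Opens) (j : U.toScheme ⟶ Spec (.of (MvPolynomial (Fin (n + 1)) k)))
      (Z : Scheme.{u}) (z : Z ⟶ X),
      IsClosedImmersion j ∧ j ≫ specStr k _ = U.ι ≫ i ≫ ProjSpace.toSpec k n ∧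
      Set.range j = PrimeSpectrum.zeroLocus (insert (l - 1) S) ∧
      AlgebraicGeometry.IsReduced Z ∧ IsClosedImmersion z ∧
      Set.range (z ≫ i) =
        ProjectiveSpectrum.zeroLocus (homogeneousSubmodule (Fin (n + 1)) k) (insert l S) ∧
      ∀ {R : Type v} [CommRing R] (μ : MotivicMeasure k R),
        μ.cl X (i ≫ ProjSpace.toSpec k n) = μ.cl U.toScheme (j ≫ specStr k _) +
          μ.cl Z ((z ≫ i) ≫ ProjSpace.toSpec k n) := by
  obtain ⟨U, j, hj, hjs, hjr, hU⟩ := exists_chart_closedImmersion i hl hS hr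
  obtain ⟨Z, z, hZ, hz, hzr⟩ := exists_reduced_closedImmersion U.isOpen.isClosed_compl
  refine ⟨U, j, Z, z, hj, hjs, hjr, hZ, hz, ?_, fun μ ↦ ?_⟩
  · have hcomp : Set.range (z ≫ i) = i '' Set.range z := by
      rw [← Set.range_comp]
      rfl
    rw [hcomp, hzr, ← Set.union_singleton, ProjectiveSpectrum.zeroLocus_union, ← hr]
    ext y
    constructor
    · rintro ⟨x, hx, rfl⟩
      exact ⟨⟨x, rfl⟩, not_not.mp fun h ↦ hx ((hU x).mpr h)⟩
    · rintro ⟨⟨x, rfl⟩, hx⟩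
      exact ⟨x, fun h ↦ (hU x).mp h hx, rfl⟩
  · rw [hjs, Category.assoc]
    refine μ.cl_scissor _ z inferInstance inferInstance inferInstance hz U ?_
    rw [hzr, compl_compl]

end Stratification

section PointStratum

variable {k : Type u} [Field k] {n : ℕ} {v : Fin (n + 1) → k} {m : Fin (n + 1)}
  {S : Set (MvPolynomial (Fin (n + 1)) k)}

attribute [local instance] MvPolynomial.gradedAlgebra

lemma X_eq_linearForm_add (v : Fin (n + 1) → k) (m i : Fin (n + 1)) :
    (X i : MvPolynomial (Fin (n + 1)) k) = linearForm v m i + C (v i) * X m := by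
  simp [linearForm]

lemma aeval_linearForm (hv : v m = 1) (i : Fin (n + 1)) :
    aeval v (linearForm v m i) = 0 := by
  simp [linearForm, hv]

lemma zeroLocus_insert_X_sub_one (hv : v m = 1) (hS : S ⊆ Ideal.span (Set.range (linearForm v m)))
    (hlS : Set.range (linearForm v m) ⊆ S) :
    PrimeSpectrum.zeroLocus (insert (X m - 1) S) =
      PrimeSpectrum.zeroLocus (RingHom.ker (aeval v : MvPolynomial (Fin (n + 1)) k →ₐ[k] k) :
        Set (MvPolynomial (Fin (n + 1)) k)) := by
  apply subset_antisymm
  · intro y hy q hq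
    have hcomp : Ideal.Quotient.mkₐ k y.asIdeal =
        (Algebra.ofId k (MvPolynomial (Fin (n + 1)) k ⧸ y.asIdeal)).comp (aeval v) := by
      ext i
      have hm : X m - 1 ∈ y.asIdeal := hy (Set.mem_insert _ _)
      have hi : linearForm v m i ∈ y.asIdeal := hy (Set.mem_insert_of_mem _ (hlS ⟨i, rfl⟩))
      have h : X i - C (v i) ∈ y.asIdeal := by
        convert y.asIdeal.add_mem hi (y.asIdeal.mul_mem_left (C (v i)) hm) using 1
        rw [linearForm]
        ring
      simpa using! Ideal.Quotient.eq.mpr h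
    have hq : aeval v q = 0 := hq
    have := DFunLike.congr_fun hcomp q
    rw [AlgHom.comp_apply, hq, map_zero] at this
    exact Ideal.Quotient.eq_zero_iff_mem.mp this
  · refine PrimeSpectrum.zeroLocus_anti_mono ?_
    rintro q (rfl | hq)
    · simp [RingHom.mem_ker, hv]
    · refine Ideal.span_le.mpr ?_ (hS hq)
      rintro _ ⟨i, rfl⟩
      exact aeval_linearForm hv i

lemma zeroLocus_insert_X_eq_empty (hlS : Set.range (linearForm v m) ⊆ S) :
    ProjectiveSpectrum.zeroLocus (homogeneousSubmodule (Fin (n + 1)) k) (insert (X m) S) = ∅ := by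
  refine Set.eq_empty_of_forall_notMem fun y hy ↦ y.not_irrelevant_le fun q hq ↦ ?_
  let I := y.asHomogeneousIdeal.toIdeal
  have hcomp : Ideal.Quotient.mkₐ k I =
      (Algebra.ofId k (MvPolynomial (Fin (n + 1)) k ⧸ I)).comp (aeval 0) := by
    ext i
    have hm : X m ∈ I := hy (Set.mem_insert _ _)
    have hi : linearForm v m i ∈ I := hy (Set.mem_insert_of_mem _ (hlS ⟨i, rfl⟩))
    have h : X i ∈ I := by
      rw [X_eq_linearForm_add v m i]
      exact I.add_mem hi (I.mul_mem_left _ hm)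
    simpa using Ideal.Quotient.eq_zero_iff_mem.mpr h
  have hq : aeval (0 : Fin (n + 1) → k) q = 0 := by
    rw [HomogeneousIdeal.mem_irrelevant_iff] at hq
    have hq0 : homogeneousComponent 0 q = 0 :=
      (decomposition.decompose'_apply q 0).symm.trans hq
    rw [homogeneousComponent_zero, C_eq_zero] at hq0
    simpa [aeval_zero, constantCoeff_eq] using hq0
  have := DFunLike.congr_fun hcomp q
  rw [AlgHom.comp_apply, hq, map_zero] at this
  exact Ideal.Quotient.eq_zero_iff_mem.mp this

end PointStratum

section CutByLinearForms

variable {k : Type u} [Field k] {n : ℕ} {v : Fin (n + 1) → k} {m : Fin (n + 1)}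
  {S : Set (MvPolynomial (Fin (n + 1)) k)}

attribute [local instance] MvPolynomial.gradedAlgebra

lemma MotivicMeasure.cl_eq_zero_of_isEmpty {R : Type v} [CommRing R] (μ : MotivicMeasure k R)
    {Z : Scheme.{u}} [IsEmpty Z] (sZ : Z ⟶ SpecBase k) [LocallyOfFiniteType sZ] [QuasiCompact sZ]
    [IsSeparated sZ] : μ.cl Z sZ = 0 := by
  have h := μ.cl_scissor sZ (𝟙 Z) inferInstance inferInstance inferInstance inferInstance ⊤
    (Subsingleton.elim _ _)
  rw [Category.id_comp, right_eq_add] at h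
  rw [← h]
  exact (μ.cl_iso _ _ Z.topIso inferInstance inferInstance inferInstance rfl).symm

lemma TranslationInvariant.sub_one {s : MvPolynomial (Fin (n + 1)) k}
    (hs : TranslationInvariant v s) : TranslationInvariant v (s - 1) := fun A _ _ a t ↦ by
  rw [map_sub, map_sub, hs A a t, map_one, map_one]

/-- Cutting a cone in projective space by linear forms vanishing at its vertex does not change its
class modulo the class of the affine line. -/
lemma exists_cut_linearForms (hv : v m = 1)
    (hS : ∀ s ∈ S, TranslationInvariant v s ∧ ∃ e, 0 < e ∧ s.IsHomogeneous e)
    {X : Scheme.{u}} [AlgebraicGeometry.IsReduced X] (i : X ⟶ ProjSpace k n) [IsClosedImmersion i]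
    (hr : Set.range i =
      ProjectiveSpectrum.zeroLocus (homogeneousSubmodule (Fin (n + 1)) k) S)
    (T : Finset (Fin (n + 1))) :
    ∃ (Z : Scheme.{u}) (z : Z ⟶ X), AlgebraicGeometry.IsReduced Z ∧ IsClosedImmersion z ∧
      Set.range (z ≫ i) = ProjectiveSpectrum.zeroLocus (homogeneousSubmodule (Fin (n + 1)) k)
        (linearForm v m '' T ∪ S) ∧
      ∀ {R : Type v} [CommRing R] (μ : MotivicMeasure k R),
        μ.cl X (i ≫ ProjSpace.toSpec k n) - μ.cl Z ((z ≫ i) ≫ ProjSpace.toSpec k n) ∈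
          Ideal.span {μ.lef} := by
  induction T using Finset.induction_on with
  | empty => exact ⟨X, 𝟙 X, inferInstance, inferInstance, by simpa using hr, fun μ ↦ by simp⟩
  | insert b T _ ih =>
    obtain ⟨Z, z, hZ, hz, hzr, hcl⟩ := ih
    have hT : ∀ s ∈ linearForm v m '' T ∪ S,
        TranslationInvariant v s ∧ ∃ e, 0 < e ∧ s.IsHomogeneous e := by
      rintro _ (⟨c, -, rfl⟩ | hs)
      · exact ⟨translationInvariant_linearForm hv c, 1, one_pos, isHomogeneous_linearForm v m c⟩
      · exact hS _ hs
    obtain ⟨U, j, W, w, hj, -, hjr, hW, hw, hwr, hscissor⟩ := exists_hyperplane_decomposition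
      (z ≫ i) (isHomogeneous_linearForm v m b) (fun s hs ↦ (hT s hs).2) hzr
    refine ⟨W, w ≫ z, hW, inferInstance, ?_, fun μ ↦ ?_⟩
    · rw [Category.assoc, hwr, Finset.coe_insert, Set.image_insert_eq, Set.insert_union]
    · have hmem : μ.cl U.toScheme (j ≫ specStr k _) ∈ Ideal.span {μ.lef} := by
        refine μ.cl_cone_mem hv ?_ j hjr
        rintro s (rfl | hs)
        · exact (translationInvariant_linearForm hv b).sub_one
        · exact (hT s hs).1
      have := Ideal.add_mem _ (hcl μ) hmem
      rw [hscissor μ, sub_add_eq_sub_sub, sub_right_comm, sub_add_cancel] at this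
      simpa only [Category.assoc] using this

end CutByLinearForms

end

/-- Let `L/k` be a finite Galois extension and let `X = V(f) ⊂ ℙⁿ_k` be a
hypersurface of degree `d ≤ n` such that the base change `X ×_k L` is a union of `d`
hyperplanes over `L`, i.e. `X ×_k L = V(h₁ ⋯ h_d)` with `h₁, …, h_d ∈ L[x₀, …, xₙ]`
homogeneous of degree 1 (algebraically: the image of `f` in `L[x₀, …, xₙ]` is the product
`h₁ ⋯ h_d`).  Then `[X] ≡ 1 mod 𝕃` in `K₀(Var_k)`, and `X` has a `k`-rational point. -/
theorem galois_union_of_hyperplanes (k : Type u) [Field k] (L : Type v) [Field L]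
    [Algebra k L] [FiniteDimensional k L] [IsGalois k L]
    (n d : ℕ) (hd : 1 ≤ d) (hdn : d ≤ n)
    (f : MvPolynomial (Fin (n + 1)) k) (hf : f.IsHomogeneous d) (hf0 : f ≠ 0)
    (h : Fin d → MvPolynomial (Fin (n + 1)) L) (hh : ∀ i, (h i).IsHomogeneous 1)
    (hsplit : MvPolynomial.map (algebraMap k L) f = ∏ i, h i)
    (X : Scheme.{u}) (sX : X ⟶ SpecBase k) (hX : IsProjSubvariety k n {f} X sX) :
    (∀ (R : Type u) [CommRing R] (μ : MotivicMeasure k R),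
        μ.cl X sX - 1 ∈ Ideal.span {μ.lef}) ∧ HasRatPoint k X sX := by
  obtain ⟨hXr, i, hi, rfl, hr⟩ := hX
  obtain ⟨m, v, hv, hfv⟩ := exists_translationInvariant hdn hh hsplit
  have hS : ∀ s ∈ ({f} : Set (MvPolynomial (Fin (n + 1)) k)),
      TranslationInvariant v s ∧ ∃ e, 0 < e ∧ s.IsHomogeneous e := by
    rintro s rfl
    exact ⟨hfv, d, hd, hf⟩
  obtain ⟨Z, z, hZ, hz, hzr, hcut⟩ := exists_cut_linearForms hv hS i hr Finset.univ
  rw [Finset.coe_univ, Set.image_univ] at hzr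
  have hS' : ∀ s ∈ Set.range (linearForm v m) ∪ {f}, ∃ e, 0 < e ∧ s.IsHomogeneous e := by
    rintro s (⟨c, rfl⟩ | rfl)
    · exact ⟨1, one_pos, isHomogeneous_linearForm v m c⟩
    · exact ⟨d, hd, hf⟩
  obtain ⟨U, j, W, w, hj, hjs, hjr, -, hw, hwr, hscissor⟩ := exists_hyperplane_decomposition
    (z ≫ i) (isHomogeneous_X k m) hS' hzr
  rw [zeroLocus_insert_X_eq_empty Set.subset_union_left] at hwr
  have : IsEmpty W := Set.range_eq_empty_iff.mp hwr
  rw [zeroLocus_insert_X_sub_one hv (Set.union_subset Ideal.subset_span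
    (Set.singleton_subset_iff.mpr (hfv.mem_span_linearForm hf hd))) Set.subset_union_left] at hjr
  obtain ⟨e, he⟩ := exists_iso_spec_of_range_eq j (aeval v)
    (fun a ↦ ⟨C a, aeval_C v a⟩) hjr
  have hpt : specStr k k = 𝟙 (SpecBase k) := Spec.map_id _
  refine ⟨fun R _ μ ↦ ?_, e.inv ≫ U.ι ≫ z, ?_⟩
  · have h := hcut μ
    rwa [hscissor μ, μ.cl_eq_zero_of_isEmpty (Z := W), add_zero, μ.cl_eq_of_iso_spec j e he, hpt,
      μ.cl_point] at h
  · rw [hjs, hpt] at he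
    have := congr(e.inv ≫ $he)
    rw [e.inv_hom_id_assoc] at this
    simpa only [Category.assoc] using this.symm
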